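/- The space of S₃ × D₃ invariants in (ℂ^{2×2})^{⊗3} is four-dimensional: the ℂ-subspace {T ∈ W | κ(T) = T, c_s(T) = T, c_ρ(T) = T, Φ(T) = T} has dimension 4, where κ is the cyclic shift induced by x⊗y⊗z ↦ z⊗x⊗y; for g ∈ {s, ρ} with s := [[0,1],[1,0]] and ρ := [[0,−1],[1,−1]], c_g is the diagonal conjugation induced by x⊗y⊗z ↦ (g x g⁻¹)⊗(g y g⁻¹)⊗(g z g⁻¹); and Φ is the transpose symmetry induced by x⊗y⊗z ↦ (J xᵀ J⁻¹)⊗(J zᵀ J⁻¹)⊗(J yᵀ J⁻¹) with J := [[0,−1],[1,0]]. -/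

import Mathlib

open scoped TensorProduct
open Matrix

noncomputable section

abbrev M2 := Matrix (Fin 2) (Fin 2) ℂ
abbrev W2 := M2 ⊗[ℂ] (M2 ⊗[ℂ] M2)

/-- the subspace of vectors fixed by a linear endomorphism -/
def fixedSubmodule (f : W2 →ₗ[ℂ] W2) : Submodule ℂ W2 where
  carrier := {T | f T = T}
  add_mem' := by
    intro x y hx hy
    show f (x + y) = x + y
    rw [map_add, hx, hy]
  zero_mem' := f.map_zero
  smul_mem' := by
    intro c x hx
    show f (c • x) = c • x
    rw [LinearMap.map_smul, hx]

def s : M2 := !![0, 1; 1, 0]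
def ρ : M2 := !![0, -1; 1, -1]
def Jmat : M2 := !![0, -1; 1, 0]

/-- A primitive cube root of unity. -/
theorem exists_omega : ∃ w : ℂ, w ^ 2 + w + 1 = 0 := by
  have h := Complex.isPrimitiveRoot_exp 3 (by norm_num)
  have h2 := h.geom_sum_eq_zero (by norm_num)
  simp only [Finset.sum_range_succ, Finset.sum_range_zero] at h2
  exact ⟨_, by linear_combination h2⟩

theorem s_inv : s⁻¹ = s := by
  apply Matrix.inv_eq_right_inv
  ext i j; fin_cases i <;> fin_cases j <;> simp [s]

theorem rho_inv : ρ⁻¹ = !![-1, 1; -1, 0] := by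
  apply Matrix.inv_eq_right_inv
  ext i j; fin_cases i <;> fin_cases j <;> simp [ρ]

theorem Jmat_inv : Jmat⁻¹ = !![0, 1; -1, 0] := by
  apply Matrix.inv_eq_right_inv
  ext i j; fin_cases i <;> fin_cases j <;> simp [Jmat]

/-- The eigenbasis of `M2`. -/
def ev (w : ℂ) : Fin 4 → M2 :=
  ![1, !![1, -2; 2, -1], !![w, 1; -w ^ 2, -w], !![-w, -w ^ 2; 1, w]]

def sgS : Fin 4 → ℂ := ![1, -1, 1, 1]
def pS : Fin 4 → Fin 4 := ![0, 1, 3, 2]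
def wt (w : ℂ) : Fin 4 → ℂ := ![1, 1, w ^ 2, w]
def sgJ : Fin 4 → ℂ := ![1, -1, -1, -1]

theorem s_ev (w : ℂ) (i : Fin 4) : s * ev w i * s⁻¹ = sgS i • ev w (pS i) := by
  rw [s_inv]
  fin_cases i <;> ext a b <;> fin_cases a <;> fin_cases b <;>
    simp [s, ev, sgS, pS, Matrix.mul_apply, Fin.sum_univ_two]

theorem rho_ev (w : ℂ) (hw : w ^ 2 + w + 1 = 0) (i : Fin 4) :
    ρ * ev w i * ρ⁻¹ = wt w i • ev w i := by
  rw [rho_inv]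
  fin_cases i <;> ext a b <;> fin_cases a <;> fin_cases b <;>
    simp [ρ, ev, wt, Matrix.mul_apply, Fin.sum_univ_two] <;> grind

theorem J_ev (w : ℂ) (i : Fin 4) : Jmat * (ev w i)ᵀ * Jmat⁻¹ = sgJ i • ev w i := by
  rw [Jmat_inv]
  fin_cases i <;> ext a b <;> fin_cases a <;> fin_cases b <;>
    simp [Jmat, ev, sgJ, Matrix.mul_apply, Fin.sum_univ_two, Matrix.vecMul, dotProduct]

theorem ev_li (w : ℂ) (hw : w ^ 2 + w + 1 = 0) : LinearIndependent ℂ (ev w) := by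
  rw [Fintype.linearIndependent_iff]
  intro g hg
  have h00 := congrFun (congrFun hg 0) 0
  have h01 := congrFun (congrFun hg 0) 1
  have h10 := congrFun (congrFun hg 1) 0
  have h11 := congrFun (congrFun hg 1) 1
  simp [Fin.sum_univ_four, ev] at h00 h01 h10 h11
  have h0 : g 0 = 0 := by grind
  have hs : (1 - w ^ 2) * (g 2 + g 3) = 0 := by grind
  have hw0 : w ≠ 0 := by grind
  have hw2 : 1 - w ^ 2 ≠ 0 := by grind
  have h23 : g 3 = - g 2 := by
    have := (mul_eq_zero.mp hs).resolve_left hw2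
    grind
  have h2 : w * g 2 = 0 := by grind
  have h2' := (mul_eq_zero.mp h2).resolve_left hw0
  intro i
  fin_cases i <;> simp <;> grind

def evB (w : ℂ) (hw : w ^ 2 + w + 1 = 0) : Module.Basis (Fin 4) ℂ M2 :=
  basisOfLinearIndependentOfCardEqFinrank (ev_li w hw) (by simp [Module.finrank_matrix])

theorem evB_apply (w : ℂ) (hw : w ^ 2 + w + 1 = 0) (i : Fin 4) : evB w hw i = ev w i := by
  simp [evB]

def BB (w : ℂ) (hw : w ^ 2 + w + 1 = 0) : Module.Basis (Fin 4 × Fin 4 × Fin 4) ℂ W2 :=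
  (evB w hw).tensorProduct ((evB w hw).tensorProduct (evB w hw))

theorem BB_apply (w : ℂ) (hw : w ^ 2 + w + 1 = 0) (i j k : Fin 4) :
    BB w hw (i, j, k) = ev w i ⊗ₜ[ℂ] (ev w j ⊗ₜ[ℂ] ev w k) := by
  simp [BB, Module.Basis.tensorProduct_apply, evB_apply]

theorem coord_monomial {ι V : Type*} [AddCommGroup V] [Module ℂ V]
    (B : Module.Basis ι ℂ V) (f : V →ₗ[ℂ] V) (c : ι → ℂ) (τ : ι → ι)
    (hτ : Function.Injective τ) (hf : ∀ i, f (B i) = c i • B (τ i)) (T : V) (i : ι) :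
    B.repr (f T) (τ i) = c i * B.repr T i := by
  classical
  have h : (B.coord (τ i)) ∘ₗ f = c i • B.coord i := by
    apply B.ext
    intro m
    simp only [LinearMap.comp_apply, hf, map_smul, Module.Basis.coord_apply, LinearMap.smul_apply,
      Module.Basis.repr_self, Finsupp.single_apply, hτ.eq_iff, smul_eq_mul]
    split_ifs with hmi
    · rw [hmi]
    · simp
  exact LinearMap.congr_fun h T

theorem coords_zero (t : Fin 4 → Fin 4 → Fin 4 → ℂ) (w : ℂ) (hw : w ^ 2 + w + 1 = 0)
    (hk : ∀ i j k, t k i j = t i j k)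
    (hs : ∀ i j k, t (pS i) (pS j) (pS k) = sgS i * sgS j * sgS k * t i j k)
    (hr : ∀ i j k, t i j k = wt w i * wt w j * wt w k * t i j k)
    (hJ : ∀ i j k, t i k j = sgJ i * sgJ j * sgJ k * t i j k)
    (h0 : t 0 0 0 = 0) (h1 : t 0 1 1 = 0) (h2 : t 0 2 3 = 0) (h3 : t 1 2 3 = 0)
    (i j k : Fin 4) : t i j k = 0 := by
  have hw0 : w ≠ 0 := by grind
  have hw3 : w ^ 3 = 1 := by grind
  have hw1 : 1 - w ≠ 0 := by grind
  have hw2 : 1 - w ^ 2 ≠ 0 := by grind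
  have key1 : ∀ x : ℂ, x = w * x → x = 0 := fun x hx =>
    (mul_eq_zero.mp (show (1 - w) * x = 0 by linear_combination hx)).resolve_left hw1
  have key2 : ∀ x : ℂ, x = w ^ 2 * x → x = 0 := fun x hx =>
    (mul_eq_zero.mp (show (1 - w ^ 2) * x = 0 by linear_combination hx)).resolve_left hw2
  have a1 := hk i j k
  have a2 := hk k i j
  have a3 := hs i j k
  have a4 := hJ i j k
  have a5 := hr i j k
  have b1 := hk 0 1 1
  have b2 := hk 1 0 1
  have c1 := hk 0 2 3
  have c2 := hk 3 0 2
  have d1 := hk 1 2 3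
  have d2 := hk 3 1 2
  have k1 := key1 (t i j k)
  have k2 := key2 (t i j k)
  fin_cases i <;> fin_cases j <;> fin_cases k <;>
    simp [pS, sgS, wt, sgJ] at a1 a2 a3 a4 a5 k1 k2 ⊢ <;> grind

/-- The general invariant. -/
def invT (w : ℂ) (a : Fin 4 → ℂ) : W2 :=
  let b : Fin 4 → Fin 4 → Fin 4 → W2 := fun i j k => ev w i ⊗ₜ[ℂ] (ev w j ⊗ₜ[ℂ] ev w k)
  a 0 • b 0 0 0 + a 1 • (b 0 1 1 + b 1 0 1 + b 1 1 0)
    + a 2 • (b 0 2 3 + b 3 0 2 + b 2 3 0 + b 0 3 2 + b 2 0 3 + b 3 2 0)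
    + a 3 • (b 1 2 3 + b 3 1 2 + b 2 3 1 - b 1 3 2 - b 2 1 3 - b 3 2 1)

def idx : Fin 4 → Fin 4 × Fin 4 × Fin 4 := ![(0, 0, 0), (0, 1, 1), (0, 2, 3), (1, 2, 3)]

theorem repr_invT (w : ℂ) (hw : w ^ 2 + w + 1 = 0) (a : Fin 4 → ℂ) (m : Fin 4) :
    (BB w hw).repr (invT w a) (idx m) = a m := by
  simp only [invT, ← BB_apply w hw, map_add, map_sub, map_smul, Module.Basis.repr_self,
    Finsupp.add_apply, Finsupp.sub_apply, Finsupp.smul_apply, Finsupp.single_apply]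
  fin_cases m <;> simp [idx]

set_option maxHeartbeats 2000000

/-- The space of `S₃ × D₃` invariants in `(ℂ^{2×2})^{⊗3}` is four-dimensional. -/
theorem S3_D3_invariants_dimension
    (κ cs cρ Φ : W2 →ₗ[ℂ] W2)
    (hκ : ∀ x y z : M2, κ (x ⊗ₜ[ℂ] (y ⊗ₜ[ℂ] z)) = z ⊗ₜ[ℂ] (x ⊗ₜ[ℂ] y))
    (hcs : ∀ x y z : M2, cs (x ⊗ₜ[ℂ] (y ⊗ₜ[ℂ] z)) =
      (s * x * s⁻¹) ⊗ₜ[ℂ] ((s * y * s⁻¹) ⊗ₜ[ℂ] (s * z * s⁻¹)))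
    (hcρ : ∀ x y z : M2, cρ (x ⊗ₜ[ℂ] (y ⊗ₜ[ℂ] z)) =
      (ρ * x * ρ⁻¹) ⊗ₜ[ℂ] ((ρ * y * ρ⁻¹) ⊗ₜ[ℂ] (ρ * z * ρ⁻¹)))
    (hΦ : ∀ x y z : M2, Φ (x ⊗ₜ[ℂ] (y ⊗ₜ[ℂ] z)) =
      (Jmat * xᵀ * Jmat⁻¹) ⊗ₜ[ℂ] ((Jmat * zᵀ * Jmat⁻¹) ⊗ₜ[ℂ] (Jmat * yᵀ * Jmat⁻¹))) :
    Module.rank ℂ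
      (fixedSubmodule κ ⊓ fixedSubmodule cs ⊓ fixedSubmodule cρ ⊓ fixedSubmodule Φ :
        Submodule ℂ W2) = 4 := by
  obtain ⟨w, hw⟩ := exists_omega
  have hw3 : w ^ 3 = 1 := by grind
  have ek : ∀ i j k, κ (BB w hw (i, j, k)) = BB w hw (k, i, j) := by
    intro i j k
    simp only [BB_apply, hκ]
  have es : ∀ i j k, cs (BB w hw (i, j, k)) =
      (sgS i * sgS j * sgS k) • BB w hw (pS i, pS j, pS k) := by
    intro i j k
    simp only [BB_apply, hcs, s_ev, ← TensorProduct.smul_tmul', TensorProduct.tmul_smul, smul_smul]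
    congr 1; ring
  have er : ∀ i j k, cρ (BB w hw (i, j, k)) =
      (wt w i * wt w j * wt w k) • BB w hw (i, j, k) := by
    intro i j k
    simp only [BB_apply, hcρ, rho_ev w hw, ← TensorProduct.smul_tmul', TensorProduct.tmul_smul,
      smul_smul]
    congr 1; ring
  have eJ : ∀ i j k, Φ (BB w hw (i, j, k)) =
      (sgJ i * sgJ j * sgJ k) • BB w hw (i, k, j) := by
    intro i j k
    simp only [BB_apply, hΦ, J_ev, ← TensorProduct.smul_tmul', TensorProduct.tmul_smul, smul_smul]
    congr 1; ring
  have hpS : Function.Injective pS := by decide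
  let S : Submodule ℂ W2 :=
    fixedSubmodule κ ⊓ fixedSubmodule cs ⊓ fixedSubmodule cρ ⊓ fixedSubmodule Φ
  let E : S →ₗ[ℂ] (Fin 4 → ℂ) :=
    (LinearMap.pi (fun m : Fin 4 => (BB w hw).coord
      (idx m)))
      ∘ₗ S.subtype
  have hEa : ∀ x m, E x m = (BB w hw).repr x.1 (idx m) := fun _ _ => rfl
  have hE : Function.Bijective E := by
    constructor
    · rw [injective_iff_map_eq_zero]
      rintro ⟨T, hT⟩ hET
      obtain ⟨⟨⟨h1, h2⟩, h3⟩, h4⟩ := hT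
      change κ T = T at h1
      change cs T = T at h2
      change cρ T = T at h3
      change Φ T = T at h4
      have hz := coords_zero (fun i j k => (BB w hw).repr T (i, j, k)) w hw
        (fun i j k => by
          have := coord_monomial (BB w hw) κ (fun _ => 1) (fun p => (p.2.2, p.1, p.2.1))
            (by rintro ⟨a, b, c⟩ ⟨a', b', c'⟩ h; simp_all)
            (by rintro ⟨a, b, c⟩; simp [ek]) T (i, j, k)
          simpa [h1] using this)
        (fun i j k => by
          have := coord_monomial (BB w hw) cs (fun p => sgS p.1 * sgS p.2.1 * sgS p.2.2)
            (fun p => (pS p.1, pS p.2.1, pS p.2.2))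
            (by rintro ⟨a, b, c⟩ ⟨a', b', c'⟩ h; simpa [hpS.eq_iff] using h)
            (by rintro ⟨a, b, c⟩; simp [es]) T (i, j, k)
          simpa only [h2] using this)
        (fun i j k => by
          have := coord_monomial (BB w hw) cρ (fun p => wt w p.1 * wt w p.2.1 * wt w p.2.2)
            (fun p => p) (fun _ _ h => h)
            (by rintro ⟨a, b, c⟩; simp [er]) T (i, j, k)
          simpa only [h3] using this)
        (fun i j k => by
          have := coord_monomial (BB w hw) Φ (fun p => sgJ p.1 * sgJ p.2.1 * sgJ p.2.2)
            (fun p => (p.1, p.2.2, p.2.1))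
            (by rintro ⟨a, b, c⟩ ⟨a', b', c'⟩ h; simp_all)
            (by rintro ⟨a, b, c⟩; simp [eJ]) T (i, j, k)
          simpa only [h4] using this)
        (congrFun hET 0) (congrFun hET 1) (congrFun hET 2) (congrFun hET 3)
      have hT0 : T = 0 := by
        apply (BB w hw).ext_elem
        rintro ⟨i, j, k⟩
        simpa using hz i j k
      subst hT0
      rfl
    · intro a
      have hmem : invT w a ∈ S := by
        refine ⟨⟨⟨?_, ?_⟩, ?_⟩, ?_⟩
        · change κ _ = _
          simp only [invT, ← BB_apply w hw, map_add, map_sub, map_smul, ek]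
          module
        · change cs _ = _
          simp only [invT, ← BB_apply w hw, map_add, map_sub, map_smul, es]
          simp [pS, sgS]
          module
        · change cρ _ = _
          simp only [invT, ← BB_apply w hw, map_add, map_sub, map_smul, er]
          have e1 : w ^ 2 * w = 1 := by grind
          have e2 : w * w ^ 2 = 1 := by grind
          simp [wt, e1, e2]
        · change Φ _ = _
          simp only [invT, ← BB_apply w hw, map_add, map_sub, map_smul, eJ]
          simp [sgJ]
          module
      refine ⟨⟨invT w a, hmem⟩, ?_⟩
      funext m
      rw [hEa]
      dsimp only
      rw [repr_invT]
  have := (LinearEquiv.ofBijective E hE).rank_eq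
  change Module.rank ℂ S = 4
  rw [this]
  simp
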